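/- arXiv:1307.4564 — 2 statements merged into one kernel-verified Lean document; each statement's English description precedes it below -/
import Mathlib

section
/- Let G = (V,D) be a directed graph with vertex set V = {1,…,K} (K ≥ 1) and no self-loops, let d_i^- denote the indegree of vertex i (the number of j with (j,i) ∈ D), and let α = α(G) be the independence number of G (computed ignoring arc orientations). Then Σ_{i=1}^K 1/(1 + d_i^-) ≤ 2·α·ln(1 + K/α). -/
open Finset

/-- The indegree of vertex `i` in the directed graph with arc set `D`. -/
def inDeg {K : ℕ} (D : Finset (Fin K × Fin K)) (i : Fin K) : ℕ :=
  (Finset.univ.filter (fun j => (j, i) ∈ D)).card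

/-- The independence number of the directed graph with arc set `D`
(arc orientations are ignored). -/
noncomputable def indepNum {K : ℕ} (D : Finset (Fin K × Fin K)) : ℕ :=
  sSup {n : ℕ | ∃ T : Finset (Fin K),
    (∀ i ∈ T, ∀ j ∈ T, i ≠ j → (i, j) ∉ D ∧ (j, i) ∉ D) ∧ T.card = n}

lemma caro_wei {V : Type*} [DecidableEq V] (A : V → V → Prop) [DecidableRel A]
    (hs : ∀ i j, A i j → A j i) (hi : ∀ i, ¬ A i i) (S : Finset V) :
    ∃ T ⊆ S, (∀ i ∈ T, ∀ j ∈ T, i ≠ j → ¬ A i j) ∧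
      ∑ i ∈ S, (1 : ℝ) / (1 + ((S.filter (fun j => A i j)).card : ℝ)) ≤ T.card := by
  induction S using Finset.strongInduction with
  | H S ih =>
    rcases S.eq_empty_or_nonempty with rfl | hne
    · exact ⟨∅, by simp, by simp, by simp⟩
    obtain ⟨v, hv, hmin⟩ := S.exists_min_image (fun i => (S.filter (fun j => A i j)).card) hne
    set N := insert v (S.filter (fun j => A v j)) with hN
    have hNS : N ⊆ S := by
      intro x hx
      simp only [hN, mem_insert, mem_filter] at hx
      rcases hx with rfl | hx
      · exact hv
      · exact hx.1
    have hNc : N.card = (S.filter (fun j => A v j)).card + 1 := by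
      rw [hN, card_insert_of_notMem]
      simp [hi]
    have hvN : v ∈ N := by simp [hN]
    obtain ⟨T, hTS, hT, hsum⟩ := ih (S \ N) (Finset.sdiff_ssubset hNS ⟨v, hvN⟩)
    have hTN : ∀ x ∈ T, x ∈ S ∧ x ≠ v ∧ ¬ A v x := by
      intro x hx
      have h := hTS hx
      simp only [hN, mem_sdiff, mem_insert, mem_filter] at h
      tauto
    have hvT : v ∉ T := fun h => (hTN v h).2.1 rfl
    refine ⟨insert v T, ?_, ?_, ?_⟩
    · intro x hx
      rcases mem_insert.1 hx with rfl | hx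
      · exact hv
      · exact (hTN x hx).1
    · intro i hi' j hj hij
      rcases mem_insert.1 hi' with rfl | hiT <;> rcases mem_insert.1 hj with rfl | hjT
      · exact absurd rfl hij
      · exact (hTN j hjT).2.2
      · exact fun h => (hTN i hiT).2.2 (hs _ _ h)
      · exact hT i hiT j hjT hij
    · rw [card_insert_of_notMem hvT, ← Finset.sum_sdiff hNS]
      push_cast
      refine add_le_add (le_trans (Finset.sum_le_sum fun i _ => ?_) hsum) ?_
      · apply one_div_le_one_div_of_le (by positivity)
        have : ((S \ N).filter (fun j => A i j)).card ≤ (S.filter (fun j => A i j)).card :=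
          card_le_card (filter_subset_filter _ sdiff_subset)
        have : (((S \ N).filter (fun j => A i j)).card : ℝ) ≤ (S.filter (fun j => A i j)).card := by
          exact_mod_cast this
        linarith
      · have h1 : ∀ i ∈ N, (1 : ℝ) / (1 + ((S.filter (fun j => A i j)).card : ℝ)) ≤
            1 / (N.card : ℝ) := by
          intro i hiN
          have h := hmin i (hNS hiN)
          have h' : ((S.filter (fun j => A v j)).card : ℝ) ≤ (S.filter (fun j => A i j)).card := by
            exact_mod_cast h
          rw [hNc]
          push_cast
          apply one_div_le_one_div_of_le (by positivity)
          linarith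
        refine (Finset.sum_le_card_nsmul _ _ _ h1).trans ?_
        rw [nsmul_eq_mul, hNc]
        push_cast
        apply le_of_eq
        field_simp

lemma exists_big {V : Type*} [DecidableEq V] (D : Finset (V × V)) (hl : ∀ i, (i, i) ∉ D)
    (a : ℕ) (ha : ∀ T : Finset V, (∀ i ∈ T, ∀ j ∈ T, i ≠ j → (i, j) ∉ D ∧ (j, i) ∉ D) → T.card ≤ a)
    (S : Finset V) (hne : S.Nonempty) :
    ∃ i ∈ S, (a : ℝ) + S.card ≤ 2 * a * (1 + ((S.filter (fun j => (j, i) ∈ D)).card : ℝ)) := by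
  obtain ⟨T, -, hT, hsum⟩ := caro_wei (fun i j => (i, j) ∈ D ∨ (j, i) ∈ D)
    (fun i j h => h.symm) (fun i => by simp [hl]) S
  have hTa : T.card ≤ a := ha T (fun i hi j hj hij => by simpa using hT i hi j hj hij)
  obtain ⟨v, hv, hmax⟩ := S.exists_max_image (fun i => (S.filter (fun j => (j, i) ∈ D)).card) hne
  refine ⟨v, hv, ?_⟩
  set e : V → ℝ := fun i => 1 + ((S.filter (fun j => (i, j) ∈ D ∨ (j, i) ∈ D)).card : ℝ) with he
  have hpos : ∀ i, 0 < e i := fun i => by simp only [he]; positivity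
  have hswap : ∑ i ∈ S, (S.filter (fun j => (i, j) ∈ D)).card
      = ∑ i ∈ S, (S.filter (fun j => (j, i) ∈ D)).card := by
    simp only [card_filter]
    rw [Finset.sum_comm]
  have hnat : ∑ i ∈ S, (1 + (S.filter (fun j => (i, j) ∈ D ∨ (j, i) ∈ D)).card)
      ≤ S.card * (1 + 2 * (S.filter (fun j => (j, v) ∈ D)).card) := by
    have h1 : ∑ i ∈ S, (S.filter (fun j => (i, j) ∈ D ∨ (j, i) ∈ D)).card ≤
        ∑ i ∈ S, ((S.filter (fun j => (i, j) ∈ D)).card + (S.filter (fun j => (j, i) ∈ D)).card) := by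
      apply Finset.sum_le_sum
      intro i _
      rw [filter_or]
      exact card_union_le _ _
    have h2 := Finset.sum_le_card_nsmul S _ _ hmax
    rw [Finset.sum_add_distrib, hswap] at h1
    rw [Finset.sum_add_distrib]
    simp only [smul_eq_mul, sum_const, mul_one] at *
    nlinarith
  have hE : ∑ i ∈ S, e i ≤ S.card * (1 + 2 * ((S.filter (fun j => (j, v) ∈ D)).card : ℝ)) := by
    simp only [he]
    exact_mod_cast hnat
  have hcs : (S.card : ℝ) ^ 2 ≤ (∑ i ∈ S, 1 / e i) * ∑ i ∈ S, e i := by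
    have := Finset.sum_sq_le_sum_mul_sum_of_sq_eq_mul S (r := fun _ => (1:ℝ)) (f := fun i => 1 / e i)
      (g := e) (fun i _ => (one_div_pos.2 (hpos i)).le) (fun i _ => (hpos i).le)
      (fun i _ => by have := (hpos i).ne'; field_simp)
    simpa using this
  have hTa' : (T.card : ℝ) ≤ a := by exact_mod_cast hTa
  have hc : (0 : ℝ) < S.card := by exact_mod_cast hne.card_pos
  have hfin : (S.card : ℝ) ^ 2 ≤ a * (S.card * (1 + 2 * ((S.filter (fun j => (j, v) ∈ D)).card : ℝ))) :=
    hcs.trans (mul_le_mul (hsum.trans hTa') hE (Finset.sum_nonneg fun i _ => (hpos i).le)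
      (by positivity))
  have : (S.card : ℝ) ≤ a * (1 + 2 * ((S.filter (fun j => (j, v) ∈ D)).card : ℝ)) := by
    by_contra! h
    nlinarith
  linarith

lemma sum_bound {V : Type*} [DecidableEq V] (D : Finset (V × V)) (hl : ∀ i, (i, i) ∉ D)
    (a : ℕ) (ha0 : 0 < a)
    (ha : ∀ T : Finset V, (∀ i ∈ T, ∀ j ∈ T, i ≠ j → (i, j) ∉ D ∧ (j, i) ∉ D) → T.card ≤ a)
    (n : ℕ) : ∀ S : Finset V, S.card = n →
    ∑ i ∈ S, (1 : ℝ) / (1 + ((S.filter (fun j => (j, i) ∈ D)).card : ℝ)) ≤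
      2 * a * Real.log (1 + (n : ℝ) / a) := by
  have ha' : (0 : ℝ) < a := by exact_mod_cast ha0
  induction n with
  | zero => intro S hS; simp [card_eq_zero.1 hS]
  | succ n ih =>
    intro S hS
    obtain ⟨v, hv, hb⟩ := exists_big D hl a ha S (card_pos.1 (by omega))
    rw [← Finset.sum_erase_add S _ hv]
    have h1 := ih (S.erase v) (by rw [card_erase_of_mem hv]; omega)
    have h2 : ∑ i ∈ S.erase v, (1 : ℝ) / (1 + ((S.filter (fun j => (j, i) ∈ D)).card : ℝ)) ≤
        ∑ i ∈ S.erase v, (1 : ℝ) / (1 + (((S.erase v).filter (fun j => (j, i) ∈ D)).card : ℝ)) := by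
      refine Finset.sum_le_sum fun i _ => ?_
      apply one_div_le_one_div_of_le (by positivity)
      have : (((S.erase v).filter (fun j => (j, i) ∈ D)).card : ℝ) ≤
          (S.filter (fun j => (j, i) ∈ D)).card := by
        exact_mod_cast card_le_card (filter_subset_filter _ (erase_subset _ _))
      linarith
    rw [hS] at hb
    push_cast at hb ⊢
    have hn : (0 : ℝ) ≤ n := Nat.cast_nonneg n
    have h3 : (1 : ℝ) / (1 + ((S.filter (fun j => (j, v) ∈ D)).card : ℝ)) ≤
        2 * a * (1 / (a + (n + 1))) := by
      rw [mul_one_div, div_le_div_iff₀ (by positivity) (by positivity)]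
      linarith
    have h4 : 1 / ((a : ℝ) + (n + 1)) ≤ Real.log (1 + ((n : ℝ) + 1) / a) - Real.log (1 + n / a) := by
      have h5 := Real.log_le_sub_one_of_pos (x := (1 + (n : ℝ) / a) / (1 + ((n : ℝ) + 1) / a))
        (by positivity)
      rw [Real.log_div (by positivity) (by positivity)] at h5
      have h6 : (1 + (n : ℝ) / a) / (1 + ((n : ℝ) + 1) / a) - 1 = - (1 / ((a : ℝ) + (n + 1))) := by
        field_simp
        ring
      linarith
    have h7 := mul_le_mul_of_nonneg_left h4 (by positivity : (0 : ℝ) ≤ 2 * a)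
    linarith

theorem stmt1 (K : ℕ) (hK : 1 ≤ K) (D : Finset (Fin K × Fin K))
    (hloop : ∀ i : Fin K, (i, i) ∉ D) :
    ∑ i : Fin K, (1 : ℝ) / (1 + (inDeg D i : ℝ))
      ≤ 2 * (indepNum D : ℝ) * Real.log (1 + (K : ℝ) / (indepNum D : ℝ)) := by
  have hbdd : BddAbove {n : ℕ | ∃ T : Finset (Fin K),
      (∀ i ∈ T, ∀ j ∈ T, i ≠ j → (i, j) ∉ D ∧ (j, i) ∉ D) ∧ T.card = n} := by
    refine ⟨K, ?_⟩
    rintro n ⟨T, -, rfl⟩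
    simpa using card_le_univ T
  have ha : ∀ T : Finset (Fin K), (∀ i ∈ T, ∀ j ∈ T, i ≠ j → (i, j) ∉ D ∧ (j, i) ∉ D) →
      T.card ≤ indepNum D := fun T hT => le_csSup hbdd ⟨T, hT, rfl⟩
  have ha0 : 0 < indepNum D := by
    have := ha {⟨0, hK⟩} (by
      intro i hi j hj hij
      rw [mem_singleton] at hi hj
      exact absurd (hi.trans hj.symm) hij)
    rw [card_singleton] at this
    omega
  exact sum_bound D hloop (indepNum D) ha0 ha K univ (by simp)
end

section
/- Let G = (V,D) be a directed graph with vertex set V = {1,…,K} (K ≥ 1) and no self-loops, and let α = α(G) be its independence number (computed ignoring arc orientations). Then G admits a dominating set R ⊆ V (i.e., for every j ∉ R there exists i ∈ R with (i,j) ∈ D) with |R| ≤ ⌈2·α·ln K⌉ + 1. -/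
open Finset

lemma turan_aux {V : Type*} [DecidableEq V] (r : V → V → Prop) [DecidableRel r]
    (hr : ∀ a, r a a) (hs : ∀ a b, r a b → r b a) (S : Finset V) :
    ∃ T ⊆ S, (∀ i ∈ T, ∀ j ∈ T, i ≠ j → ¬ r i j) ∧
      S.card ^ 2 ≤ T.card * ∑ u ∈ S, (S.filter (r u)).card := by
  induction S using Finset.strongInduction with
  | H S ih =>
  rcases S.eq_empty_or_nonempty with rfl | hne
  · exact ⟨∅, by simp⟩
  obtain ⟨v, hv, hmin⟩ := S.exists_min_image (fun u => (S.filter (r u)).card) hne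
  set A := S.filter (r v) with hA
  set S' := S.filter (fun w => ¬ r v w) with hS'
  have hss : S' ⊂ S := by
    refine ⟨filter_subset _ _, fun h => ?_⟩
    have := h hv
    simp [hS', hr] at this
  obtain ⟨T, hT, hind, hc⟩ := ih S' hss
  have hvT : v ∉ T := fun h => by
    have := hT h
    simp [hS', hr] at this
  have hTn : ∀ j ∈ T, ¬ r v j := fun j hj => (mem_filter.1 (hT hj)).2
  refine ⟨insert v T, ?_, ?_, ?_⟩
  · exact insert_subset hv (hT.trans hss.1)
  · intro i hi j hj hij
    rcases mem_insert.1 hi with rfl | hi'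
    · rcases mem_insert.1 hj with rfl | hj
      · exact absurd rfl hij
      · exact hTn j hj
    · rcases mem_insert.1 hj with rfl | hj
      · exact fun h => hTn i hi' (hs _ _ h)
      · exact hind i hi' j hj hij
  · rw [card_insert_of_notMem hvT]
    have hcard : A.card + S'.card = S.card := card_filter_add_card_filter_not _
    have hsum : ∑ u ∈ A, (S.filter (r u)).card + ∑ u ∈ S', (S.filter (r u)).card
        = ∑ u ∈ S, (S.filter (r u)).card := sum_filter_add_sum_filter_not _ _ _
    have h1 : A.card * A.card ≤ ∑ u ∈ A, (S.filter (r u)).card := by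
      have := A.card_nsmul_le_sum (fun u => (S.filter (r u)).card) A.card
        (fun u hu => hmin u (mem_filter.1 hu).1)
      simpa using this
    have h2 : ∑ u ∈ S', (S'.filter (r u)).card ≤ ∑ u ∈ S', (S.filter (r u)).card :=
      sum_le_sum fun u _ => card_le_card (filter_subset_filter _ hss.1)
    rw [← hcard, ← hsum]
    generalize ∑ u ∈ S', (S'.filter (r u)).card = W at *
    generalize ∑ u ∈ A, (S.filter (r u)).card = X at *
    generalize ∑ u ∈ S', (S.filter (r u)).card = Y at *
    generalize A.card = a at *
    generalize S'.card = n at *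
    generalize T.card = t at *
    have h3 : (a + n) ^ 2 ≤ (t + 1) * (a * a + W) := by
      rcases Nat.eq_zero_or_pos t with rfl | ht
      · have : n = 0 := by simpa using hc
        subst this
        nlinarith
      · have h4 : 2 * a * n ≤ a * a * t + W := by
          zify at *
          by_contra hcon
          push Not at hcon
          nlinarith [sq_nonneg ((a : ℤ) * t - n), mul_lt_mul_of_pos_left hcon ht]
        nlinarith
    exact h3.trans (Nat.mul_le_mul_left _ (by omega))

lemma indep_le {K : ℕ} (D : Finset (Fin K × Fin K)) (T : Finset (Fin K))
    (h : ∀ i ∈ T, ∀ j ∈ T, i ≠ j → (i, j) ∉ D ∧ (j, i) ∉ D) : T.card ≤ indepNum D := by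
  refine le_csSup ⟨K, ?_⟩ ⟨T, h, rfl⟩
  rintro n ⟨T, -, rfl⟩
  simpa using T.card_le_univ

lemma exists_big_s7 {K : ℕ} (D : Finset (Fin K × Fin K)) (S : Finset (Fin K)) (hS : S.Nonempty) :
    ∃ v ∈ S, S.card ≤ 2 * indepNum D * (S.filter (fun w => v = w ∨ (v, w) ∈ D)).card := by
  obtain ⟨T, -, hT, hc⟩ := turan_aux (fun a b : Fin K => a = b ∨ (a, b) ∈ D ∨ (b, a) ∈ D)
    (fun a => Or.inl rfl) (fun a b h => by tauto) S
  have hTa := indep_le D T (fun i hi j hj hij => by have := hT i hi j hj hij; tauto)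
  by_contra! hcon
  set o : Fin K → ℕ := fun v => (S.filter (fun w => v = w ∨ (v, w) ∈ D)).card with ho
  have h1 : ∑ u ∈ S, (S.filter (fun w => u = w ∨ (u, w) ∈ D ∨ (w, u) ∈ D)).card
      ≤ 2 * ∑ u ∈ S, o u := by
    have h2 : ∑ u ∈ S, (S.filter (fun w => w = u ∨ (w, u) ∈ D)).card = ∑ u ∈ S, o u := by
      simp only [ho, card_filter]
      exact sum_comm
    rw [two_mul]
    nth_rewrite 2 [← h2]
    rw [← sum_add_distrib]
    refine sum_le_sum fun u _ => ?_
    refine le_trans (card_le_card ?_) (card_union_le _ _)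
    intro w
    simp only [mem_union, mem_filter]
    tauto
  have h3 : ∑ u ∈ S, 2 * indepNum D * o u < ∑ u ∈ S, S.card := sum_lt_sum_of_nonempty hS hcon
  rw [← mul_sum, sum_const, smul_eq_mul] at h3
  have := Nat.mul_le_mul hTa h1
  nlinarith

lemma dom_aux {K : ℕ} (D : Finset (Fin K × Fin K)) (S : Finset (Fin K)) (hS : S.Nonempty) :
    ∃ R : Finset (Fin K), (∀ j ∈ S, j ∉ R → ∃ i ∈ R, (i, j) ∈ D) ∧
      (R.card : ℝ) ≤ 2 * (indepNum D : ℝ) * Real.log S.card + 1 := by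
  induction S using Finset.strongInduction with
  | H S ih =>
  obtain ⟨v, hv, hbig⟩ := exists_big_s7 D S hS
  have hn : 0 < S.card := hS.card_pos
  have hnR : (0:ℝ) < S.card := by exact_mod_cast hn
  have hcard := card_filter_add_card_filter_not (s := S) (fun w => v = w ∨ (v, w) ∈ D)
  set S' := S.filter (fun w => ¬ (v = w ∨ (v, w) ∈ D)) with hS'
  rcases S'.eq_empty_or_nonempty with he | hne
  · refine ⟨{v}, ?_, ?_⟩
    · intro j hj hjv
      refine ⟨v, by simp, ?_⟩
      by_contra hcon
      have : j ∈ S' := by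
        simp only [hS', mem_filter]
        refine ⟨hj, ?_⟩
        rintro (rfl | h)
        · simp at hjv
        · exact hcon h
      simp [he] at this
    · have : 0 ≤ Real.log S.card := Real.log_natCast_nonneg _
      simp
      positivity
  · have hss : S' ⊂ S := by
      refine ⟨filter_subset _ _, fun h => ?_⟩
      have := h hv
      simp [hS'] at this
    obtain ⟨R, hR, hc⟩ := ih S' hss hne
    refine ⟨insert v R, ?_, ?_⟩
    · intro j hj hjv
      simp only [mem_insert, not_or] at hjv
      by_cases h : (v, j) ∈ D
      · exact ⟨v, by simp, h⟩
      · obtain ⟨i, hi, hij⟩ := hR j (by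
          simp only [hS', mem_filter]
          exact ⟨hj, by rintro (h' | h'); exacts [hjv.1 h'.symm, h h']⟩) hjv.2
        exact ⟨i, mem_insert_of_mem hi, hij⟩
    · have h1 : ((insert v R).card : ℝ) ≤ R.card + 1 := by exact_mod_cast card_insert_le v R
      have hn' : (0:ℝ) < S'.card := by exact_mod_cast hne.card_pos
      have hl := Real.log_le_sub_one_of_pos (div_pos hn' hnR)
      rw [Real.log_div hn'.ne' hnR.ne'] at hl
      have hb : (S.card : ℝ) ≤ 2 * indepNum D * (S.card - S'.card) := by
        have h5 : ((S.filter (fun w => v = w ∨ (v, w) ∈ D)).card : ℝ) + S'.card = S.card := by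
          exact_mod_cast hcard
        have h6 : (S.card : ℝ) - S'.card = (S.filter (fun w => v = w ∨ (v, w) ∈ D)).card := by
          linarith
        rw [h6]
        exact_mod_cast hbig
      have hb2 : 1 ≤ 2 * (indepNum D : ℝ) * (1 - S'.card / S.card) := by
        have : 2 * (indepNum D : ℝ) * (1 - S'.card / S.card)
          = 2 * indepNum D * (S.card - S'.card) / S.card := by field_simp
        rw [this, le_div_iff₀ hnR]
        linarith
      have := mul_le_mul_of_nonneg_left hl (by positivity : (0:ℝ) ≤ 2 * indepNum D)
      linarith

theorem stmt7 (K : ℕ) (hK : 1 ≤ K) (D : Finset (Fin K × Fin K))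
    (hloop : ∀ i : Fin K, (i, i) ∉ D) :
    ∃ R : Finset (Fin K), (∀ j : Fin K, j ∉ R → ∃ i ∈ R, (i, j) ∈ D) ∧
      (R.card : ℤ) ≤ ⌈2 * (indepNum D : ℝ) * Real.log (K : ℝ)⌉ + 1 := by
  obtain ⟨R, hR, hc⟩ := dom_aux D univ ⟨⟨0, hK⟩, mem_univ _⟩
  refine ⟨R, fun j hj => hR j (mem_univ _) hj, ?_⟩
  rw [card_univ, Fintype.card_fin] at hc
  have h := Int.le_ceil (2 * (indepNum D : ℝ) * Real.log (K : ℝ))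
  have : ((R.card : ℤ) : ℝ) ≤ ((⌈2 * (indepNum D : ℝ) * Real.log (K : ℝ)⌉ + 1 : ℤ) : ℝ) := by
    push_cast
    linarith
  exact_mod_cast this
end
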